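/- Let p ∈ [1,∞). There exists a constant C > 0, depending only on ρ and p, such that for all ε > 0 and all u ∈ W^{3,p}(ℝⁿ): ‖L_ε u − L u‖_{L^p(ℝⁿ)} ≤ C ε ‖u‖_{W^{3,p}(ℝⁿ)}, where L_ε : W^{2,p}(ℝⁿ) → L^p(ℝⁿ) is the bounded extension of the nonlocal operator u ↦ P.V. ∫_{ℝⁿ} J_ε(x−y)(u(x) − u(y)) dy and L u := −div(M∇u). -/

import Mathlib

open MeasureTheory Filter Topology ENNReal

noncomputable section

abbrev EV (n : ℕ) := EuclideanSpace ℝ (Fin n)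

/-- The kernel `J(x) = ρ(x)/|x|²`. -/
def kernelJ {n : ℕ} (ρ : EV n → ℝ) (x : EV n) : ℝ := ρ x / ‖x‖ ^ 2

/-- The rescaled density `ρ_ε(x) = ε^{-n} ρ(x/ε)`. -/
def scaled {n : ℕ} (ρ : EV n → ℝ) (ε : ℝ) (x : EV n) : ℝ := (ε ^ n)⁻¹ * ρ (ε⁻¹ • x)

/-- Assumption (A1): `ρ` is measurable, nonnegative, not a.e. zero, even,
and `∫ ρ(x)(1+|x|) dx < ∞`. -/
def A1 {n : ℕ} (ρ : EV n → ℝ) : Prop :=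
  Measurable ρ ∧ (∀ x, 0 ≤ ρ x) ∧ ¬ (ρ =ᵐ[volume] (fun _ => (0 : ℝ))) ∧
  (∀ᵐ x : EV n ∂volume, ρ (-x) = ρ x) ∧
  Integrable (fun x : EV n => ρ x * (1 + ‖x‖)) volume

/-- `L_ε u (x) = ∫_{ℝⁿ} J_ε(x-y) (u(x) - u(y) - ∇u(x)·(x-y)) dy`. -/
def nlOp {n : ℕ} (ρ : EV n → ℝ) (ε : ℝ) (u : EV n → ℝ) (x : EV n) : ℝ :=
  ∫ y : EV n, kernelJ (scaled ρ ε) (x - y) * (u x - u y - fderiv ℝ u x (x - y))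

/-- The classical partial derivative `∂ᵢ u`. -/
def partialD {n : ℕ} (i : Fin n) (u : EV n → ℝ) : EV n → ℝ :=
  fun x => fderiv ℝ u x (EuclideanSpace.single i 1)

/-- Iterated classical partial derivatives along a list of directions. -/
def partialDList {n : ℕ} : List (Fin n) → (EV n → ℝ) → (EV n → ℝ)
  | [], u => u
  | i :: l, u => partialD i (partialDList l u)

/-- The momentum matrix `M = (1/2)∫_{ℝⁿ} J(z) z ⊗ z dz`. -/
def momentum {n : ℕ} (ρ : EV n → ℝ) : Matrix (Fin n) (Fin n) ℝ :=
  Matrix.of fun i j => (1 / 2 : ℝ) * ∫ z : EV n, kernelJ ρ z * z i * z j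

/-- `v = ∂ᵢ u` weakly on `Ω`. -/
def WeakDerivOn {n : ℕ} (Ω : Set (EV n)) (i : Fin n) (u v : EV n → ℝ) : Prop :=
  ∀ φ : EV n → ℝ, ContDiff ℝ (⊤ : ℕ∞) φ → HasCompactSupport φ → tsupport φ ⊆ Ω →
    ∫ x in Ω, u x * partialD i φ x = - ∫ x in Ω, v x * φ x

/-- `D` is a system of weak partial derivatives of `u` on `Ω` up to order `k`,
all lying in `L^p(Ω)`; i.e. `D` witnesses that `u ∈ W^{k,p}(Ω)`. -/
def IsSobDerivs {n : ℕ} (Ω : Set (EV n)) (k : ℕ) (p : ℝ≥0∞) (u : EV n → ℝ)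
    (D : List (Fin n) → EV n → ℝ) : Prop :=
  D [] = u ∧
  (∀ l : List (Fin n), l.length < k → ∀ i : Fin n, WeakDerivOn Ω i (D l) (D (i :: l))) ∧
  (∀ l : List (Fin n), l.length ≤ k → MemLp (D l) p (volume.restrict Ω))

/-- `u ∈ W^{k,p}(Ω)`. -/
def MemW {n : ℕ} (Ω : Set (EV n)) (k : ℕ) (p : ℝ≥0∞) (u : EV n → ℝ) : Prop :=
  ∃ D, IsSobDerivs Ω k p u D

/-- The `W^{k,p}`-norm computed from a system `D` of weak derivatives:
the sum of the `L^p` norms of all weak derivatives of order at most `k`. -/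
def WNormD {n : ℕ} (k : ℕ) (p : ℝ≥0∞) (μ : Measure (EV n))
    (D : List (Fin n) → EV n → ℝ) : ℝ≥0∞ :=
  ∑' l : List (Fin n), if l.length ≤ k then eLpNorm (D l) p μ else 0

/-- `L` is a bounded linear extension to `W^{2,p}(ℝⁿ)`, with operator bound `C`,
of the nonlocal operator `L_ε` (defined by the principal-value formula on `C_c²(ℝⁿ)`). -/
def IsNLExt {n : ℕ} (ρ : EV n → ℝ) (p : ℝ≥0∞) (ε C : ℝ)
    (L : (EV n → ℝ) → EV n → ℝ) : Prop :=
  (∀ u : EV n → ℝ, ContDiff ℝ 2 u → HasCompactSupport u → L u =ᵐ[volume] nlOp ρ ε u) ∧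
  (∀ u v : EV n → ℝ, MemW Set.univ 2 p u → MemW Set.univ 2 p v → ∀ a b : ℝ,
    L (fun x => a * u x + b * v x) =ᵐ[volume] fun x => a * L u x + b * L v x) ∧
  (∀ u : EV n → ℝ, MemW Set.univ 2 p u → MemLp (L u) p volume) ∧
  (∀ u D, IsSobDerivs Set.univ 2 p u D →
    eLpNorm (L u) p volume ≤ ENNReal.ofReal C * WNormD 2 p volume D)

open scoped ContDiff Convolution


theorem jensen_lintegral {Y : Type*} [MeasurableSpace Y] (ν : Measure Y)
    (q : ℝ) (hq : 1 ≤ q) (h : Y → ℝ≥0∞) (hh : AEMeasurable h ν) :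
    (∫⁻ y, h y ∂ν) ^ q ≤ (ν Set.univ) ^ (q - 1) * ∫⁻ y, h y ^ q ∂ν := by
  have h0 : 0 < q := by linarith
  have := eLpNorm'_le_eLpNorm'_mul_rpow_measure_univ (f := h) (μ := ν) one_pos hq
    hh.aestronglyMeasurable
  simp only [eLpNorm', enorm_eq_self, ENNReal.rpow_one, div_one] at this
  calc (∫⁻ y, h y ∂ν) ^ q
      ≤ ((∫⁻ y, h y ^ q ∂ν) ^ (1 / q) * ν Set.univ ^ (1 - 1 / q)) ^ q := by gcongr
    _ = _ := by
      rw [ENNReal.mul_rpow_of_nonneg _ _ h0.le, ← ENNReal.rpow_mul, ← ENNReal.rpow_mul, mul_comm]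
      have e1 : (1 - 1 / q) * q = q - 1 := by field_simp
      have e2 : 1 / q * q = 1 := by field_simp
      rw [e1, e2, ENNReal.rpow_one]

theorem young_lintegral {n : ℕ} {Y : Type*} [MeasurableSpace Y] (ν : Measure Y)
    [IsFiniteMeasure ν] (a : Y → EV n) (ha : Measurable a) (g : EV n → ℝ≥0∞) (hg : Measurable g)
    (q : ℝ) (hq : 1 ≤ q) :
    ∫⁻ x, (∫⁻ y, g (x - a y) ∂ν) ^ q ≤ (ν Set.univ) ^ q * ∫⁻ x, g x ^ q := by
  have h0 : 0 < q := by linarith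
  calc ∫⁻ x, (∫⁻ y, g (x - a y) ∂ν) ^ q
      ≤ ∫⁻ x, (ν Set.univ) ^ (q - 1) * ∫⁻ y, g (x - a y) ^ q ∂ν := by
        refine lintegral_mono fun x => jensen_lintegral ν q hq _ ?_
        exact (by fun_prop : Measurable fun y => g (x - a y)).aemeasurable
    _ = (ν Set.univ) ^ (q - 1) * ∫⁻ x, ∫⁻ y, g (x - a y) ^ q ∂ν := by
        rw [lintegral_const_mul' _ _ (ENNReal.rpow_ne_top_of_nonneg (by linarith) (measure_ne_top _ _))]
    _ = (ν Set.univ) ^ (q - 1) * ∫⁻ y, (∫⁻ x, g (x - a y) ^ q) ∂ν := by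
        rw [lintegral_lintegral_swap]
        exact (by fun_prop : Measurable fun z : EV n × Y => g (z.1 - a z.2) ^ q).aemeasurable
    _ = (ν Set.univ) ^ (q - 1) * ∫⁻ y, (∫⁻ x, g x ^ q) ∂ν := by
        congr 1
        refine lintegral_congr fun y => ?_
        exact lintegral_sub_right_eq_self (fun x => g x ^ q) (a y)
    _ = (ν Set.univ) ^ q * ∫⁻ x, g x ^ q := by
        rw [lintegral_const, mul_comm (∫⁻ x, g x ^ q), ← mul_assoc]
        congr 1
        nth_rw 2 [← ENNReal.rpow_one (ν Set.univ)]
        rw [← ENNReal.rpow_add_of_nonneg _ _ (by linarith) (by norm_num)]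
        congr 1; ring

theorem young_eLpNorm {n : ℕ} {Y : Type*} [MeasurableSpace Y] (ν : Measure Y)
    [IsFiniteMeasure ν] (a : Y → EV n) (ha : Measurable a) (g : EV n → ℝ) (hg : Measurable g)
    (p : ℝ≥0∞) (hp1 : 1 ≤ p) (hp : p ≠ ⊤) (f : EV n → ℝ) 
    (hf : ∀ x, ‖f x‖ₑ ≤ ∫⁻ y, ‖g (x - a y)‖ₑ ∂ν) :
    eLpNorm f p volume ≤ ν Set.univ * eLpNorm g p volume := by
  have hp0 : p ≠ 0 := by rintro rfl; simp at hp1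
  have hq : 1 ≤ p.toReal := by
    have := ENNReal.toReal_mono hp hp1; simpa using this
  have h0 : 0 < p.toReal := by linarith
  rw [eLpNorm_eq_lintegral_rpow_enorm_toReal hp0 hp, eLpNorm_eq_lintegral_rpow_enorm_toReal hp0 hp]
  have := young_lintegral ν a ha (fun x => ‖g x‖ₑ) (by fun_prop) _ hq
  calc (∫⁻ x, ‖f x‖ₑ ^ p.toReal) ^ (1 / p.toReal)
      ≤ ((ν Set.univ) ^ p.toReal * ∫⁻ x, ‖g x‖ₑ ^ p.toReal) ^ (1 / p.toReal) := by
        gcongr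
        refine le_trans (lintegral_mono fun x => ?_) this
        gcongr
        exact hf x
    _ = _ := by
        rw [ENNReal.mul_rpow_of_nonneg _ _ (by positivity), ← ENNReal.rpow_mul]
        have e2 : p.toReal * (1 / p.toReal) = 1 := by field_simp
        rw [e2, ENNReal.rpow_one]


theorem partialD_contDiff {n : ℕ} (i : Fin n) {u : EV n → ℝ} (hu : ContDiff ℝ (⊤ : ℕ∞) u) :
    ContDiff ℝ (⊤ : ℕ∞) (partialD i u) := by
  have := hu.fderiv_right (m := (⊤ : ℕ∞)) (by exact_mod_cast le_top)
  exact this.clm_apply contDiff_const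

theorem partialDList_contDiff {n : ℕ} (l : List (Fin n)) {u : EV n → ℝ}
    (hu : ContDiff ℝ (⊤ : ℕ∞) u) : ContDiff ℝ (⊤ : ℕ∞) (partialDList l u) := by
  induction l with
  | nil => exact hu
  | cons i l ih => exact partialD_contDiff i ih

theorem partialD_compact {n : ℕ} (i : Fin n) {u : EV n → ℝ} (hu : HasCompactSupport u) :
    HasCompactSupport (partialD i u) :=
  (hu.fderiv (𝕜 := ℝ)).comp_left (g := fun T : EV n →L[ℝ] ℝ => T (EuclideanSpace.single i 1)) rfl

theorem partialDList_compact {n : ℕ} (l : List (Fin n)) {u : EV n → ℝ}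
    (hu : HasCompactSupport u) : HasCompactSupport (partialDList l u) := by
  induction l with
  | nil => exact hu
  | cons i l ih => exact partialD_compact i ih

theorem partialDList_append {n : ℕ} (l : List (Fin n)) (i : Fin n) (u : EV n → ℝ) :
    partialDList (l ++ [i]) u = partialDList l (partialD i u) := by
  induction l with
  | nil => rfl
  | cons j l ih => simp only [List.cons_append, partialDList, ih]

theorem smooth_diff {n : ℕ} {u : EV n → ℝ} (hu : ContDiff ℝ (⊤ : ℕ∞) u) :
    Differentiable ℝ u := hu.differentiable (by simp)

theorem partialDList_add {n : ℕ} (l : List (Fin n)) {u v : EV n → ℝ}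
    (hu : ContDiff ℝ (⊤ : ℕ∞) u) (hv : ContDiff ℝ (⊤ : ℕ∞) v) :
    partialDList l (fun x => u x + v x) = fun x => partialDList l u x + partialDList l v x := by
  induction l with
  | nil => rfl
  | cons i l ih =>
    simp only [partialDList, ih]
    ext x
    simp only [partialD]
    rw [fderiv_fun_add (smooth_diff (partialDList_contDiff l hu) x)
      (smooth_diff (partialDList_contDiff l hv) x)]
    rfl

theorem partialDList_smul {n : ℕ} (l : List (Fin n)) {u : EV n → ℝ} (c : ℝ)
    (hu : ContDiff ℝ (⊤ : ℕ∞) u) :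
    partialDList l (fun x => c * u x) = fun x => c * partialDList l u x := by
  induction l with
  | nil => rfl
  | cons i l ih =>
    simp only [partialDList, ih]
    ext x
    simp only [partialD]
    rw [fderiv_const_mul (smooth_diff (partialDList_contDiff l hu) x)]
    rfl

theorem partialD_mul {n : ℕ} (i : Fin n) {u v : EV n → ℝ}
    (hu : ContDiff ℝ (⊤ : ℕ∞) u) (hv : ContDiff ℝ (⊤ : ℕ∞) v) :
    partialD i (fun x => u x * v x) = fun x => u x * partialD i v x + partialD i u x * v x := by
  ext x
  simp only [partialD]
  rw [fderiv_fun_mul (smooth_diff hu x) (smooth_diff hv x)]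
  simp [mul_comm]

theorem partialD_scale {n : ℕ} (i : Fin n) {u : EV n → ℝ} (r : ℝ)
    (hu : ContDiff ℝ (⊤ : ℕ∞) u) :
    partialD i (fun x => u (r • x)) = fun x => r * partialD i u (r • x) := by
  ext x
  simp only [partialD]
  have h1 : HasFDerivAt (fun x : EV n => r • x) (r • ContinuousLinearMap.id ℝ (EV n)) x :=
    (hasFDerivAt_id x).const_smul r
  have h2 := ((smooth_diff hu (r • x)).hasFDerivAt).comp x h1
  have := h2.fderiv
  simp only [Function.comp_def] at this
  rw [this]
  simp

theorem fderiv_eq_sum {n : ℕ} (u : EV n → ℝ) (x z : EV n) :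
    fderiv ℝ u x z = ∑ i, z i * partialD i u x := by
  have hz : z = ∑ i, z i • EuclideanSpace.single i (1 : ℝ) := by
    ext j; simp [Finset.sum_apply, Pi.single_apply]
  conv_lhs => rw [hz]
  simp [map_sum, partialD]

theorem classical_weak {n : ℕ} (i : Fin n) {u : EV n → ℝ} (hu : ContDiff ℝ (⊤ : ℕ∞) u) :
    WeakDerivOn Set.univ i u (partialD i u) := by
  intro φ hφ hc _
  simp only [Measure.restrict_univ, partialD]
  have hcφ : Continuous φ := hφ.continuous
  have hcu : Continuous u := hu.continuous
  rw [integral_mul_fderiv_eq_neg_fderiv_mul_of_integrable]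
  · exact ((partialD_contDiff i hu).continuous.mul hcφ).integrable_of_hasCompactSupport
      (hc.mul_left)
  · exact (hcu.mul (partialD_contDiff i hφ).continuous).integrable_of_hasCompactSupport
      ((partialD_compact i hc).mul_left)
  · exact (hcu.mul hcφ).integrable_of_hasCompactSupport (hc.mul_left)
  · exact fun x _ => smooth_diff hu x
  · exact fun x _ => smooth_diff hφ x

theorem hasDerivAt_line {n : ℕ} {ψ : EV n → ℝ} (hψ : ContDiff ℝ (⊤ : ℕ∞) ψ) (x z : EV n) (t : ℝ) :
    HasDerivAt (fun t : ℝ => ψ (x - t • z)) (- ∑ i, z i * partialD i ψ (x - t • z)) t := by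
  rw [← fderiv_eq_sum]
  have h1 : HasDerivAt (fun t : ℝ => x - t • z) (-z) t := by
    simpa using ((hasDerivAt_id t).smul_const z).const_sub x
  have h2 := ((smooth_diff hψ (x - t • z)).hasFDerivAt).comp_hasDerivAt t h1
  simpa [Function.comp_def] using h2

/-- Third-order Taylor remainder bound. -/
theorem taylor3 {n : ℕ} {φ : EV n → ℝ} (hφ : ContDiff ℝ (⊤ : ℕ∞) φ) (x z : EV n) :
    |φ x - φ (x - z) - fderiv ℝ φ x z
      + (1 / 2) * ∑ i, ∑ j, z i * z j * partialDList [i, j] φ x|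
    ≤ ‖z‖ ^ 3 * ∫ t in (0 : ℝ)..1, ∑ i, ∑ j, ∑ k, |partialDList [i, j, k] φ (x - t • z)| := by
  set g0 : ℝ → ℝ := fun t => φ (x - t • z) with hg0
  set g1 : ℝ → ℝ := fun t => - ∑ k, z k * partialDList [k] φ (x - t • z) with hg1
  set g2 : ℝ → ℝ := fun t => ∑ k, ∑ j, z k * (z j * partialDList [j, k] φ (x - t • z)) with hg2
  set g3 : ℝ → ℝ := fun t =>
    - ∑ k, ∑ j, ∑ i, z k * (z j * (z i * partialDList [i, j, k] φ (x - t • z))) with hg3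
  have d0 : ∀ t, HasDerivAt g0 (g1 t) t := fun t => hasDerivAt_line hφ x z t
  have d1 : ∀ t, HasDerivAt g1 (g2 t) t := by
    intro t
    have := (HasDerivAt.fun_sum (u := Finset.univ) fun k _ =>
      (hasDerivAt_line (partialDList_contDiff [k] hφ) x z t).const_mul (z k)).neg
    refine HasDerivAt.congr_deriv (f := g1) this ?_
    simp only [hg2, Finset.mul_sum, mul_neg, Finset.sum_neg_distrib, neg_neg, partialDList]
  have d2 : ∀ t, HasDerivAt g2 (g3 t) t := by
    intro t
    have := (HasDerivAt.fun_sum (u := Finset.univ) fun k _ =>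
      HasDerivAt.fun_sum (u := Finset.univ) fun j _ =>
      ((hasDerivAt_line (partialDList_contDiff [j, k] hφ) x z t).const_mul (z j)).const_mul (z k))
    refine HasDerivAt.congr_deriv (f := g2) this ?_
    simp only [hg3, Finset.mul_sum, mul_neg, Finset.sum_neg_distrib, neg_neg, partialDList]
  have c3 : Continuous g3 := by
    simp only [hg3]
    refine Continuous.neg (continuous_finsetSum _ fun k _ => continuous_finsetSum _ fun j _ =>
      continuous_finsetSum _ fun i _ => ?_)
    have := (partialDList_contDiff [i, j, k] hφ).continuous
    fun_prop
  have cG : Continuous fun t : ℝ => ∑ i, ∑ j, ∑ k, |partialDList [i, j, k] φ (x - t • z)| := by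
    refine (continuous_finsetSum _ fun k _ => continuous_finsetSum _ fun j _ =>
      continuous_finsetSum _ fun i _ => ?_)
    have := (partialDList_contDiff [k, j, i] hφ).continuous
    fun_prop
  have dh : ∀ t, HasDerivAt (fun t => g0 t + (1 - t) * g1 t + (1 - t) ^ 2 / 2 * g2 t)
      ((1 - t) ^ 2 / 2 * g3 t) t := by
    intro t
    have e1 : HasDerivAt (fun t : ℝ => 1 - t) (-1) t := by
      simpa using (hasDerivAt_id t).const_sub 1
    have := ((d0 t).add (e1.mul (d1 t))).add (((e1.pow 2).div_const 2).mul (d2 t))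
    refine HasDerivAt.congr_deriv
      (f := fun t => g0 t + (1 - t) * g1 t + (1 - t) ^ 2 / 2 * g2 t) this ?_
    simp; ring
  have hI := intervalIntegral.integral_eq_sub_of_hasDerivAt (a := 0) (b := 1) (fun t _ => dh t)
    ((by fun_prop : Continuous fun t : ℝ => (1 - t) ^ 2 / 2 * g3 t).intervalIntegrable _ _)
  have hE : φ x - φ (x - z) - fderiv ℝ φ x z
      + (1 / 2) * ∑ i, ∑ j, z i * z j * partialDList [i, j] φ x
      = - ∫ t in (0 : ℝ)..1, (1 - t) ^ 2 / 2 * g3 t := by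
    rw [hI, fderiv_eq_sum]
    simp only [hg0, hg1, hg2, one_smul, zero_smul, sub_zero]
    rw [Finset.sum_comm]
    have : ∀ i j, z j * z i * partialDList [j, i] φ x = z i * (z j * partialDList [j, i] φ x) := by
      intros; ring
    simp only [this]
    simp only [partialDList]
    ring
  rw [hE, abs_neg, ← intervalIntegral.integral_const_mul]
  refine (intervalIntegral.abs_integral_le_integral_abs zero_le_one).trans ?_
  refine intervalIntegral.integral_mono_on zero_le_one
    ((by fun_prop : Continuous fun t : ℝ => |(1 - t) ^ 2 / 2 * g3 t|).intervalIntegrable _ _)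
    ((by fun_prop : Continuous fun t : ℝ => ‖z‖ ^ 3 *
      ∑ i, ∑ j, ∑ k, |partialDList [i, j, k] φ (x - t • z)|).intervalIntegrable _ _) ?_
  intro t ht
  have hz : ∀ i, |z i| ≤ ‖z‖ := fun i => by simpa using PiLp.norm_apply_le z i
  have h3 : |g3 t| ≤ ‖z‖ ^ 3 * ∑ i, ∑ j, ∑ k, |partialDList [i, j, k] φ (x - t • z)| := by
    simp only [hg3, abs_neg]
    calc _ ≤ ∑ k, ∑ j, ∑ i, ‖z‖ ^ 3 * |partialDList [i, j, k] φ (x - t • z)| := by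
          refine (Finset.abs_sum_le_sum_abs _ _).trans (Finset.sum_le_sum fun k _ => ?_)
          refine (Finset.abs_sum_le_sum_abs _ _).trans (Finset.sum_le_sum fun j _ => ?_)
          refine (Finset.abs_sum_le_sum_abs _ _).trans (Finset.sum_le_sum fun i _ => ?_)
          rw [abs_mul, abs_mul, abs_mul, pow_three, mul_assoc, mul_assoc]
          gcongr <;> apply hz
      _ = _ := by
          simp only [Finset.mul_sum]
          rw [Finset.sum_comm]
          rw [Finset.sum_congr rfl fun j _ => Finset.sum_comm]
          rw [Finset.sum_comm]
  rw [abs_mul]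
  have h4 : |(1 - t) ^ 2 / 2| ≤ 1 := by
    rw [abs_of_nonneg (by positivity)]
    nlinarith [ht.1, ht.2]
  calc _ ≤ 1 * |g3 t| := by gcongr
    _ ≤ _ := by rw [one_mul]; exact h3


theorem integrable_rho {n : ℕ} {ρ : EV n → ℝ} (hρ : A1 ρ) : Integrable ρ volume := by
  obtain ⟨hm, h0, -, -, hi⟩ := hρ
  refine hi.mono' hm.aestronglyMeasurable (ae_of_all _ fun x => ?_)
  rw [Real.norm_eq_abs, abs_of_nonneg (h0 x)]
  nlinarith [h0 x, norm_nonneg x, mul_nonneg (h0 x) (norm_nonneg x)]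

theorem integrable_rho_norm {n : ℕ} {ρ : EV n → ℝ} (hρ : A1 ρ) :
    Integrable (fun x => ρ x * ‖x‖) volume := by
  obtain ⟨hm, h0, -, -, hi⟩ := hρ
  refine hi.mono' (by fun_prop) (ae_of_all _ fun x => ?_)
  rw [Real.norm_eq_abs, abs_of_nonneg (mul_nonneg (h0 x) (norm_nonneg x))]
  nlinarith [h0 x, norm_nonneg x, mul_nonneg (h0 x) (norm_nonneg x)]

theorem integrable_moment {n : ℕ} {ρ : EV n → ℝ} (hρ : A1 ρ) (i j : Fin n) :
    Integrable (fun z : EV n => kernelJ ρ z * z i * z j) volume := by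
  have hm := hρ.1
  have h0 := hρ.2.1
  refine (integrable_rho hρ).mono' ?_ (ae_of_all _ fun z => ?_)
  · unfold kernelJ
    have h1 : Measurable fun z : EV n => z i := by fun_prop
    have h2 : Measurable fun z : EV n => z j := by fun_prop
    exact (((hm.div (by fun_prop)).mul h1).mul h2).aestronglyMeasurable
  · have hz : ∀ i, |z i| ≤ ‖z‖ := fun i => by simpa using PiLp.norm_apply_le z i
    rw [Real.norm_eq_abs, abs_mul, abs_mul, kernelJ, abs_div, abs_of_nonneg (h0 z),
      abs_of_nonneg (by positivity : 0 ≤ ‖z‖ ^ 2)]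
    calc ρ z / ‖z‖ ^ 2 * |z i| * |z j| ≤ ρ z / ‖z‖ ^ 2 * ‖z‖ * ‖z‖ := by
          have := div_nonneg (h0 z) (by positivity : 0 ≤ ‖z‖ ^ 2)
          gcongr <;> apply hz
      _ ≤ ρ z := by
          by_cases hzz : ‖z‖ = 0
          · simp [hzz, h0 z]
          · apply le_of_eq; field_simp

theorem scaled_moment_eq {n : ℕ} (ρ : EV n → ℝ) {ε : ℝ} (hε : 0 < ε) (i j : Fin n) (z : EV n) :
    kernelJ (scaled ρ ε) z * z i * z j
      = (ε ^ n)⁻¹ * (fun w : EV n => kernelJ ρ w * w i * w j) (ε⁻¹ • z) := by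
  simp only [kernelJ, scaled, norm_smul, PiLp.smul_apply, smul_eq_mul, norm_inv, Real.norm_eq_abs,
    abs_of_pos hε]
  by_cases hz : ‖z‖ = 0
  · simp [hz]
  · field_simp

theorem scaled_norm_eq {n : ℕ} (ρ : EV n → ℝ) {ε : ℝ} (hε : 0 < ε) (z : EV n) :
    kernelJ (scaled ρ ε) z * ‖z‖ ^ 3
      = (ε * (ε ^ n)⁻¹) * (fun w : EV n => ρ w * ‖w‖) (ε⁻¹ • z) := by
  simp only [kernelJ, scaled, norm_smul, norm_inv, Real.norm_eq_abs, abs_of_pos hε]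
  by_cases hz : ‖z‖ = 0
  · simp [hz]
  · field_simp

theorem integral_scale {n : ℕ} (F : EV n → ℝ) {ε : ℝ} (hε : 0 < ε) :
    ∫ z, F (ε⁻¹ • z) = ε ^ n * ∫ z, F z := by
  rw [Measure.integral_comp_smul]
  simp [abs_of_pos hε]

theorem scaled_moment {n : ℕ} {ρ : EV n → ℝ} (hρ : A1 ρ) {ε : ℝ} (hε : 0 < ε) (i j : Fin n) :
    Integrable (fun z : EV n => kernelJ (scaled ρ ε) z * z i * z j) volume ∧
    (1 / 2) * ∫ z : EV n, kernelJ (scaled ρ ε) z * z i * z j = momentum ρ i j := by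
  simp only [scaled_moment_eq ρ hε]
  constructor
  · exact ((integrable_moment hρ i j).comp_smul (by positivity : ε⁻¹ ≠ 0)).const_mul _
  · rw [integral_const_mul, integral_scale (fun w : EV n => kernelJ ρ w * w i * w j) hε]
    simp only [momentum, Matrix.of_apply]
    field_simp

theorem scaled_norm {n : ℕ} {ρ : EV n → ℝ} (hρ : A1 ρ) {ε : ℝ} (hε : 0 < ε) :
    Integrable (fun z : EV n => kernelJ (scaled ρ ε) z * ‖z‖ ^ 3) volume ∧
    ∫ z : EV n, kernelJ (scaled ρ ε) z * ‖z‖ ^ 3 = ε * ∫ z, ρ z * ‖z‖ := by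
  simp only [scaled_norm_eq ρ hε]
  constructor
  · exact ((integrable_rho_norm hρ).comp_smul (by positivity : ε⁻¹ ≠ 0)).const_mul _
  · rw [integral_const_mul, integral_scale (fun w : EV n => ρ w * ‖w‖) hε]
    field_simp

theorem measurable_kernel {n : ℕ} {ρ : EV n → ℝ} (hρ : A1 ρ) (ε : ℝ) :
    Measurable (kernelJ (scaled ρ ε)) := by
  have := hρ.1
  unfold kernelJ scaled
  fun_prop

theorem kernel_nonneg {n : ℕ} {ρ : EV n → ℝ} (hρ : A1 ρ) {ε : ℝ} (hε : 0 < ε) (z : EV n) :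
    0 ≤ kernelJ (scaled ρ ε) z := by
  have := hρ.2.1 (ε⁻¹ • z)
  unfold kernelJ scaled
  positivity

/-- The sum of absolute values of third derivatives. -/
def thirdG {n : ℕ} (φ : EV n → ℝ) (x : EV n) : ℝ :=
  ∑ i, ∑ j, ∑ k, |partialDList [i, j, k] φ x|

theorem thirdG_cont {n : ℕ} {φ : EV n → ℝ} (hφ : ContDiff ℝ (⊤ : ℕ∞) φ) :
    Continuous (thirdG φ) :=
  continuous_finsetSum _ fun k _ => continuous_finsetSum _ fun j _ =>
      continuous_finsetSum _ fun i _ => (partialDList_contDiff [k, j, i] hφ).continuous.abs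

theorem thirdG_nonneg {n : ℕ} (φ : EV n → ℝ) (x : EV n) : 0 ≤ thirdG φ x :=
  Finset.sum_nonneg fun _ _ => Finset.sum_nonneg fun _ _ => Finset.sum_nonneg fun _ _ =>
    abs_nonneg _

theorem thirdG_bdd {n : ℕ} {φ : EV n → ℝ} (hφ : ContDiff ℝ (⊤ : ℕ∞) φ)
    (hc : HasCompactSupport φ) : ∃ B, ∀ x, thirdG φ x ≤ B := by
  have h : ∀ l : List (Fin n), ∃ B, ∀ x, |partialDList l φ x| ≤ B := fun l => by
    obtain ⟨B, hB⟩ := (partialDList_compact l hc).exists_bound_of_continuous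
      (partialDList_contDiff l hφ).continuous
    exact ⟨B, hB⟩
  choose B hB using h
  exact ⟨∑ i, ∑ j, ∑ k, B [i, j, k], fun x => Finset.sum_le_sum fun _ _ =>
    Finset.sum_le_sum fun _ _ => Finset.sum_le_sum fun _ _ => hB _ x⟩

/-- Taylor remainder. -/
def remR {n : ℕ} (φ : EV n → ℝ) (x z : EV n) : ℝ :=
  φ x - φ (x - z) - fderiv ℝ φ x z + (1 / 2) * ∑ i, ∑ j, z i * z j * partialDList [i, j] φ x

theorem remR_cont {n : ℕ} {φ : EV n → ℝ} (hφ : ContDiff ℝ (⊤ : ℕ∞) φ) (x : EV n) :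
    Continuous (remR φ x) := by
  unfold remR
  have := hφ.continuous
  fun_prop

theorem nlOp_rem {n : ℕ} {ρ : EV n → ℝ} (hρ : A1 ρ) {ε : ℝ} (hε : 0 < ε) {φ : EV n → ℝ}
    (hφ : ContDiff ℝ (⊤ : ℕ∞) φ) (hc : HasCompactSupport φ) (x : EV n) :
    nlOp ρ ε φ x + ∑ i, ∑ j, momentum ρ i j * partialDList [i, j] φ x
      = ∫ z, kernelJ (scaled ρ ε) z * remR φ x z := by
  obtain ⟨B, hB⟩ := thirdG_bdd hφ hc
  set K := kernelJ (scaled ρ ε) with hK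
  have hKm : Measurable K := measurable_kernel hρ ε
  have i1 : Integrable (fun z => K z * remR φ x z) volume := by
    refine ((scaled_norm hρ hε).1.mul_const B).mono'
      (hKm.aestronglyMeasurable.mul (remR_cont hφ x).aestronglyMeasurable)
      (ae_of_all _ fun z => ?_)
    rw [Real.norm_eq_abs, abs_mul, abs_of_nonneg (kernel_nonneg hρ hε z), mul_assoc]
    refine mul_le_mul_of_nonneg_left ((taylor3 hφ x z).trans ?_) (kernel_nonneg hρ hε z)
    gcongr
    have hcont : Continuous fun t : ℝ => thirdG φ (x - t • z) :=
      (thirdG_cont hφ).comp (by fun_prop)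
    have := intervalIntegral.integral_mono_on (a := 0) (b := 1) zero_le_one
      (hcont.intervalIntegrable _ _) ((continuous_const (y := B)).intervalIntegrable (μ := volume) _ _)
      (fun t _ => hB _)
    simp only [intervalIntegral.integral_const, sub_zero, one_smul] at this
    exact this
  have i2 : Integrable (fun z => ∑ i, ∑ j, (1 / 2) * (K z * z i * z j) * partialDList [i, j] φ x)
      volume :=
    integrable_finsetSum _ fun i _ => integrable_finsetSum _ fun j _ =>
      (((scaled_moment hρ hε i j).1.const_mul _).mul_const _)
  have e2 : ∑ i, ∑ j, momentum ρ i j * partialDList [i, j] φ x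
      = ∫ z, ∑ i, ∑ j, (1 / 2) * (K z * z i * z j) * partialDList [i, j] φ x := by
    rw [integral_finsetSum]
    · refine Finset.sum_congr rfl fun i _ => ?_
      rw [integral_finsetSum]
      · refine Finset.sum_congr rfl fun j _ => ?_
        rw [integral_mul_const, integral_const_mul, ← (scaled_moment hρ hε i j).2]
      · exact fun j _ => (((scaled_moment hρ hε i j).1.const_mul _).mul_const _)
    · exact fun i _ => integrable_finsetSum _ fun j _ =>
        (((scaled_moment hρ hε i j).1.const_mul _).mul_const _)
  have e1 : nlOp ρ ε φ x = ∫ z, (K z * remR φ x z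
      - ∑ i, ∑ j, (1 / 2) * (K z * z i * z j) * partialDList [i, j] φ x) := by
    unfold nlOp
    rw [← integral_sub_left_eq_self (fun z => (K z * remR φ x z
      - ∑ i, ∑ j, (1 / 2) * (K z * z i * z j) * partialDList [i, j] φ x)) volume x]
    refine integral_congr_ae (ae_of_all _ fun y => ?_)
    simp only [remR, _root_.sub_sub_cancel, mul_add, Finset.mul_sum]
    rw [add_sub_assoc, ← Finset.sum_sub_distrib, Finset.sum_eq_zero, add_zero]
    intro i _
    rw [← Finset.sum_sub_distrib]
    refine Finset.sum_eq_zero fun j _ => ?_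
    ring
  rw [e1, e2, integral_sub i1 i2, sub_add_cancel]

theorem smooth_rate {n : ℕ} {ρ : EV n → ℝ} (hρ : A1 ρ) {ε : ℝ} (hε : 0 < ε) {φ : EV n → ℝ}
    (hφ : ContDiff ℝ (⊤ : ℕ∞) φ) (hc : HasCompactSupport φ)
    (p : ℝ≥0∞) (hp1 : 1 ≤ p) (hp : p ≠ ⊤) :
    eLpNorm (fun x => nlOp ρ ε φ x + ∑ i, ∑ j, momentum ρ i j * partialDList [i, j] φ x) p volume
      ≤ ENNReal.ofReal (ε * ∫ z, ρ z * ‖z‖) * eLpNorm (thirdG φ) p volume := by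
  set w : EV n → ℝ≥0∞ := fun z => ENNReal.ofReal (kernelJ (scaled ρ ε) z * ‖z‖ ^ 3) with hw
  have hwm : Measurable w := by
    have := measurable_kernel hρ ε
    fun_prop
  have hwt : ∫⁻ z, w z = ENNReal.ofReal (ε * ∫ z, ρ z * ‖z‖) := by
    rw [← (scaled_norm hρ hε).2, ofReal_integral_eq_lintegral_ofReal (scaled_norm hρ hε).1]
    exact ae_of_all _ fun z => mul_nonneg (kernel_nonneg hρ hε z) (by positivity)
  set μ := (volume : Measure (EV n)).withDensity w with hμ
  have : IsFiniteMeasure μ := isFiniteMeasure_withDensity (by rw [hwt]; exact ofReal_ne_top)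
  set ν := μ.prod ((volume : Measure ℝ).restrict (Set.Ioc 0 1)) with hν
  have hνu : ν Set.univ = ENNReal.ofReal (ε * ∫ z, ρ z * ‖z‖) := by
    rw [hν, ← Set.univ_prod_univ, Measure.prod_prod, hμ, withDensity_apply _ MeasurableSet.univ,
      Measure.restrict_univ, hwt]
    simp
  rw [← hνu]
  have hGc := thirdG_cont hφ
  have hGm := hGc.measurable
  refine young_eLpNorm ν (fun y : EV n × ℝ => y.2 • y.1) (by fun_prop) (thirdG φ)
    hGc.measurable p hp1 hp _ fun x => ?_
  rw [nlOp_rem hρ hε hφ hc x]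
  refine (enorm_integral_le_lintegral_enorm _).trans ?_
  rw [hν, lintegral_prod _ (by fun_prop), hμ, lintegral_withDensity_eq_lintegral_mul _ hwm]
  · refine lintegral_mono fun z => ?_
    simp only [Pi.mul_apply, hw]
    have hcont : Continuous fun t : ℝ => thirdG φ (x - t • z) := hGc.comp (by fun_prop)
    have h1 : ∫⁻ t in Set.Ioc (0 : ℝ) 1, ‖thirdG φ (x - t • z)‖ₑ
        = ENNReal.ofReal (∫ t in (0 : ℝ)..1, thirdG φ (x - t • z)) := by
      rw [intervalIntegral.integral_of_le zero_le_one, ofReal_integral_eq_lintegral_ofReal]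
      · refine lintegral_congr fun t => ?_
        rw [Real.enorm_eq_ofReal (thirdG_nonneg _ _)]
      · exact (hcont.intervalIntegrable 0 1).1
      · exact ae_of_all _ fun t => thirdG_nonneg _ _
    rw [h1, ← ENNReal.ofReal_mul
      (mul_nonneg (kernel_nonneg hρ hε z) (by positivity)), ← ofReal_norm]
    apply ENNReal.ofReal_le_ofReal
    rw [Real.norm_eq_abs, abs_mul, abs_of_nonneg (kernel_nonneg hρ hε z), mul_assoc]
    exact mul_le_mul_of_nonneg_left (taylor3 hφ x z) (kernel_nonneg hρ hε z)
  · refine Measurable.lintegral_prod_right' (f := fun q : EV n × ℝ => ‖thirdG φ (x - q.2 • q.1)‖ₑ) ?_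
    fun_prop


/-- Mollification. -/
def moll {n : ℕ} (b : ContDiffBump (0 : EV n)) (u : EV n → ℝ) : EV n → ℝ :=
  u ⋆[ContinuousLinearMap.lsmul ℝ ℝ, volume] b.normed volume

theorem moll_apply {n : ℕ} (b : ContDiffBump (0 : EV n)) (u : EV n → ℝ) (x : EV n) :
    moll b u x = ∫ t, u t * b.normed volume (x - t) := rfl

theorem moll_apply' {n : ℕ} (b : ContDiffBump (0 : EV n)) (u : EV n → ℝ) (x : EV n) :
    moll b u x = ∫ t, b.normed volume t * u (x - t) := by
  unfold moll
  rw [convolution_lsmul_swap]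
  simp [mul_comm]

theorem moll_contDiff {n : ℕ} (b : ContDiffBump (0 : EV n)) {u : EV n → ℝ}
    (hu : LocallyIntegrable u volume) : ContDiff ℝ (⊤ : ℕ∞) (moll b u) :=
  b.hasCompactSupport_normed.contDiff_convolution_right _ hu b.contDiff_normed

theorem moll_partial {n : ℕ} (b : ContDiffBump (0 : EV n)) {u v : EV n → ℝ}
    (hu : LocallyIntegrable u volume) (i : Fin n) (hw : WeakDerivOn Set.univ i u v) :
    partialD i (moll b u) = moll b v := by
  ext x
  have hη : ContDiff ℝ (⊤ : ℕ∞) (b.normed volume) := b.contDiff_normed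
  have h1 := (b.hasCompactSupport_normed (μ := volume)).hasFDerivAt_convolution_right
    (ContinuousLinearMap.lsmul ℝ ℝ) hu (hη.of_le (by exact_mod_cast le_top)) x
  unfold partialD
  unfold moll at *
  rw [h1.fderiv, convolution_precompR_apply _ hu (b.hasCompactSupport_normed.fderiv ℝ)
    (hη.continuous_fderiv (by simp))]
  simp only [convolution_lsmul, smul_eq_mul]
  have hφ : ContDiff ℝ (⊤ : ℕ∞) (fun t => b.normed volume (x - t)) :=
    hη.comp (contDiff_const.sub contDiff_id)
  have hφc : HasCompactSupport (fun t => b.normed volume (x - t)) :=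
    (b.hasCompactSupport_normed (μ := volume)).comp_homeomorph (Homeomorph.subLeft x)
  have := hw _ hφ hφc (Set.subset_univ _)
  have hd : ∀ t, partialD i (fun t => b.normed volume (x - t)) t
      = - fderiv ℝ (b.normed volume) (x - t) (EuclideanSpace.single i 1) := by
    intro t
    unfold partialD
    have h2 : HasFDerivAt (fun t : EV n => x - t) (-ContinuousLinearMap.id ℝ (EV n)) t :=
      (hasFDerivAt_id t).const_sub x
    have h3 := ((smooth_diff hη (x - t)).hasFDerivAt).comp t h2
    have h4 := h3.fderiv
    simp only [Function.comp_def] at h4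
    rw [h4]; simp
  simp only [hd, Measure.restrict_univ, mul_neg, integral_neg] at this
  exact neg_injective this

theorem moll_norm {n : ℕ} (b : ContDiffBump (0 : EV n)) {u : EV n → ℝ}
    (hu : AEStronglyMeasurable u volume) (p : ℝ≥0∞) (hp1 : 1 ≤ p) (hp : p ≠ ⊤) :
    eLpNorm (moll b u) p volume ≤ eLpNorm u p volume := by
  have h1 : moll b u = moll b (hu.mk u) := by
    ext x
    simp only [moll_apply]
    refine integral_congr_ae ?_
    filter_upwards [hu.ae_eq_mk] with t ht
    rw [ht]
  rw [h1, eLpNorm_congr_ae hu.ae_eq_mk]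
  set g := hu.mk u
  have hg : Measurable g := hu.stronglyMeasurable_mk.measurable
  set w : EV n → ℝ≥0∞ := fun t => ENNReal.ofReal (b.normed volume t) with hw
  have hc : Continuous (b.normed (volume : Measure (EV n))) := b.continuous_normed
  have hwm : Measurable w := by have := hc.measurable; fun_prop
  have hw1 : ∫⁻ t, w t = 1 := by
    rw [← ofReal_integral_eq_lintegral_ofReal b.integrable_normed
      (ae_of_all _ fun t => b.nonneg_normed t), b.integral_normed, ENNReal.ofReal_one]
  have : IsFiniteMeasure ((volume : Measure (EV n)).withDensity w) :=
    isFiniteMeasure_withDensity (by rw [hw1]; simp)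
  have h2 := young_eLpNorm ((volume : Measure (EV n)).withDensity w) (fun t => t) measurable_id
    g hg p hp1 hp (moll b g) (fun x => ?_)
  · rwa [withDensity_apply _ MeasurableSet.univ, Measure.restrict_univ, hw1, one_mul] at h2
  · rw [moll_apply', lintegral_withDensity_eq_lintegral_mul _ hwm (by fun_prop)]
    refine (enorm_integral_le_lintegral_enorm _).trans (le_of_eq ?_)
    refine lintegral_congr fun t => ?_
    rw [enorm_mul, Real.enorm_eq_ofReal (b.nonneg_normed t)]
    rfl

theorem moll_sub {n : ℕ} (b : ContDiffBump (0 : EV n)) {u v : EV n → ℝ}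
    (hu : LocallyIntegrable u volume) (hv : LocallyIntegrable v volume) :
    moll b (u - v) = moll b u - moll b v := by
  ext x
  have hi : ∀ w : EV n → ℝ, LocallyIntegrable w volume →
      Integrable (fun t => w t * b.normed volume (x - t)) volume := fun w hw =>
    b.hasCompactSupport_normed.convolutionExists_right (ContinuousLinearMap.lsmul ℝ ℝ) hw
      b.continuous_normed x
  simp only [Pi.sub_apply, moll_apply, sub_mul]
  exact integral_sub (hi u hu) (hi v hv)

theorem moll_cont_approx {n : ℕ} {g : EV n → ℝ} (hg : Continuous g) (hc : HasCompactSupport g)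
    (p : ℝ≥0∞) (hp : p ≠ ⊤) {δ : ℝ} (hδ : 0 < δ) :
    ∃ r > 0, ∀ b : ContDiffBump (0 : EV n), b.rOut < r →
      eLpNorm (moll b g - g) p volume ≤ ENNReal.ofReal δ := by
  set S := Metric.cthickening 1 (tsupport g) with hS
  have hSc : IsCompact S := hc.isCompact.cthickening
  set V := (volume S) ^ (1 / p.toReal) with hV
  have hVt : V ≠ ⊤ := ENNReal.rpow_ne_top_of_nonneg (by positivity) hSc.measure_lt_top.ne
  set κ := δ / (V.toReal + 1) with hκ
  have hκ0 : 0 < κ := by positivity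
  obtain ⟨r, hr, hu⟩ := Metric.uniformContinuous_iff.1 (hc.uniformContinuous_of_continuous hg) κ hκ0
  refine ⟨min r 1, by positivity, fun b hb => ?_⟩
  have hd : ∀ x, dist (moll b g x) (g x) ≤ κ := by
    intro x
    have := b.dist_normed_convolution_le (μ := volume) (x₀ := x) (ε := κ)
      hg.aestronglyMeasurable (fun y hy => (hu (lt_of_lt_of_le (Metric.mem_ball.1 hy)
        (hb.le.trans (min_le_left _ _)))).le)
    rw [convolution_lsmul] at this
    rw [moll_apply']
    exact this
  have h2 : eLpNorm (moll b g - g) p volume ≤ ENNReal.ofReal κ * V := by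
    refine eLpNorm_sub_le_of_dist_bdd volume hp hSc.measurableSet hκ0.le hd ?_ ?_
    · intro x hx
      by_contra hxS
      apply hx
      rw [moll_apply']
      refine integral_eq_zero_of_ae (ae_of_all _ fun t => ?_)
      by_cases ht : t ∈ Metric.ball (0 : EV n) b.rOut
      · have : g (x - t) = 0 := by
          by_contra hne
          apply hxS
          refine Metric.mem_cthickening_of_dist_le x (x - t) 1 _ (subset_tsupport g hne) ?_
          simp only [dist_eq_norm, _root_.sub_sub_cancel]
          have := mem_ball_zero_iff.1 ht
          exact this.le.trans (hb.le.trans (min_le_right _ _))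
        simp [this]
      · rw [← b.support_normed_eq (μ := volume)] at ht
        simp [Function.notMem_support.1 ht]
    · exact (subset_tsupport g).trans (Metric.self_subset_cthickening _)
  refine h2.trans ?_
  rw [← ENNReal.ofReal_toReal hVt, ← ENNReal.ofReal_mul hκ0.le]
  apply ENNReal.ofReal_le_ofReal
  rw [hκ, div_mul_eq_mul_div, div_le_iff₀ (by positivity)]
  nlinarith [ENNReal.toReal_nonneg (a := V)]

theorem moll_approx {n : ℕ} {u : EV n → ℝ} (p : ℝ≥0∞) (hp1 : 1 ≤ p) (hp : p ≠ ⊤)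
    (hu : MemLp u p volume) {δ : ℝ} (hδ : 0 < δ) :
    ∃ r > 0, ∀ b : ContDiffBump (0 : EV n), b.rOut < r →
      eLpNorm (moll b u - u) p volume ≤ ENNReal.ofReal δ := by
  have hδ3 : 0 < δ / 3 := by positivity
  obtain ⟨g, hc, hug, hg, hgm⟩ := hu.exists_hasCompactSupport_eLpNorm_sub_le hp
    (ENNReal.ofReal_pos.2 hδ3).ne'
  obtain ⟨r, hr, h⟩ := moll_cont_approx hg hc p hp hδ3
  refine ⟨r, hr, fun b hb => ?_⟩
  have hul := hu.locallyIntegrable hp1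
  have hgl := hgm.locallyIntegrable hp1
  have e : moll b u - u = moll b (u - g) + ((moll b g - g) - (u - g)) := by
    rw [moll_sub b hul hgl]; ring
  have hs : AEStronglyMeasurable (u - g) volume := hu.1.sub hgm.1
  have m1 : AEStronglyMeasurable (moll b (u - g)) volume :=
    (moll_contDiff b (hul.sub hgl)).continuous.aestronglyMeasurable
  have m2 : AEStronglyMeasurable (moll b g - g) volume :=
    ((moll_contDiff b hgl).continuous.sub hg).aestronglyMeasurable
  rw [e]
  refine (eLpNorm_add_le m1 (m2.sub hs) hp1).trans ?_
  refine (add_le_add ((moll_norm b hs p hp1 hp).trans hug)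
    ((eLpNorm_sub_le m2 hs hp1).trans (add_le_add (h b hb) hug))).trans (le_of_eq ?_)
  rw [← ENNReal.ofReal_add hδ3.le hδ3.le, ← ENNReal.ofReal_add hδ3.le (by positivity)]
  congr 1; ring

theorem moll_partialDList {n : ℕ} (k : ℕ) (p : ℝ≥0∞) (hp1 : 1 ≤ p) {u : EV n → ℝ}
    {D : List (Fin n) → EV n → ℝ} (hD : IsSobDerivs Set.univ k p u D)
    (b : ContDiffBump (0 : EV n)) (l : List (Fin n)) (hl : l.length ≤ k) :
    partialDList l (moll b u) = moll b (D l) := by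
  obtain ⟨h0, hw, hm⟩ := hD
  simp only [Measure.restrict_univ] at hm
  induction l with
  | nil => rw [h0]; rfl
  | cons i l ih =>
    have hl' : l.length < k := by simpa using hl
    simp only [partialDList]
    rw [ih hl'.le]
    exact moll_partial b ((hm l hl'.le).locallyIntegrable hp1) i (hw l hl' i)

/-- Smooth approximation (not yet compactly supported). -/
theorem smooth_approx {n : ℕ} (k : ℕ) (p : ℝ≥0∞) (hp1 : 1 ≤ p) (hp : p ≠ ⊤) {u : EV n → ℝ}
    {D : List (Fin n) → EV n → ℝ} (hD : IsSobDerivs Set.univ k p u D) {δ : ℝ} (hδ : 0 < δ) :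
    ∃ v : EV n → ℝ, ContDiff ℝ (⊤ : ℕ∞) v ∧ ∀ l : List (Fin n), l.length ≤ k →
      MemLp (partialDList l v) p volume ∧
      eLpNorm (partialDList l v - D l) p volume ≤ ENNReal.ofReal δ := by
  have hm := hD.2.2
  simp only [Measure.restrict_univ] at hm
  have h1 : ∀ l : List (Fin n), ∃ r > 0, l.length ≤ k → ∀ b : ContDiffBump (0 : EV n),
      b.rOut < r → eLpNorm (moll b (D l) - D l) p volume ≤ ENNReal.ofReal δ := by
    intro l
    by_cases hl : l.length ≤ k
    · obtain ⟨r, hr, h⟩ := moll_approx p hp1 hp (hm l hl) hδ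
      exact ⟨r, hr, fun _ => h⟩
    · exact ⟨1, one_pos, fun h => absurd h hl⟩
  choose r hr h using h1
  have hfin : {l : List (Fin n) | l.length ≤ k}.Finite := List.finite_length_le _ _
  have : ∃ s > 0, ∀ l ∈ hfin.toFinset, s < r l := by
    have hne : hfin.toFinset.Nonempty := ⟨[], by simp⟩
    refine ⟨hfin.toFinset.inf' hne r / 2, ?_, fun l hl => ?_⟩
    · have : 0 < hfin.toFinset.inf' hne r := (Finset.lt_inf'_iff _).2 fun l _ => hr l
      positivity
    · have h1 : hfin.toFinset.inf' hne r ≤ r l := Finset.inf'_le _ hl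
      have := hr l
      linarith
  obtain ⟨s, hs, hsr⟩ := this
  let b : ContDiffBump (0 : EV n) := ⟨s / 2, s, by positivity, by linarith⟩
  have hul : LocallyIntegrable u volume := by
    have := hm [] (by simp)
    rw [hD.1] at this
    exact this.locallyIntegrable hp1
  refine ⟨moll b u, moll_contDiff b hul, fun l hl => ?_⟩
  rw [moll_partialDList k p hp1 hD b l hl]
  refine ⟨⟨?_, ?_⟩, h l hl b (hsr l (by simpa using hl))⟩
  · exact (moll_contDiff b ((hm l hl).locallyIntegrable hp1)).continuous.aestronglyMeasurable
  · exact (moll_norm b (hm l hl).1 p hp1 hp).trans_lt (hm l hl).2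


/-- Scaling radius. -/
def rk (k : ℕ) : ℝ := ((k : ℝ) + 1)⁻¹

theorem rk_pos (k : ℕ) : 0 < rk k := by unfold rk; positivity

theorem rk_tendsto : Tendsto rk atTop (𝓝 0) := by
  have := tendsto_one_div_add_atTop_nhds_zero_nat (𝕜 := ℝ)
  simp only [one_div] at this
  exact this

theorem scale_contDiff {n : ℕ} {χ : EV n → ℝ} (hχ : ContDiff ℝ (⊤ : ℕ∞) χ) (r : ℝ) :
    ContDiff ℝ (⊤ : ℕ∞) (fun x => χ (r • x)) :=
  hχ.comp (contDiff_const_smul r)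

theorem eLpNorm_mul_bdd {n : ℕ} (p : ℝ≥0∞) {f w : EV n → ℝ} {B : ℝ} (hB : ∀ x, |f x| ≤ B) :
    eLpNorm (fun x => f x * w x) p volume ≤ ENNReal.ofReal B * eLpNorm w p volume := by
  refine eLpNorm_le_mul_eLpNorm_of_ae_le_mul (ae_of_all _ fun x => ?_) p
  rw [Real.norm_eq_abs, abs_mul, Real.norm_eq_abs]
  exact mul_le_mul_of_nonneg_right (hB x) (abs_nonneg _)

theorem cut_comm {n : ℕ} (p : ℝ≥0∞) (hp1 : 1 ≤ p) (l : List (Fin n)) :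
    ∀ χ : EV n → ℝ, ContDiff ℝ (⊤ : ℕ∞) χ → HasCompactSupport χ →
    ∀ v : EV n → ℝ, ContDiff ℝ (⊤ : ℕ∞) v →
      (∀ m : List (Fin n), m.length ≤ l.length → MemLp (partialDList m v) p volume) →
      Tendsto (fun k : ℕ => eLpNorm (fun x => partialDList l (fun y => χ (rk k • y) * v y) x
        - χ (rk k • x) * partialDList l v x) p volume) atTop (𝓝 0) := by
  induction l using List.reverseRecOn with
  | nil =>
    intro χ _ _ v _ _
    simp only [partialDList, sub_self]
    simp
  | append_singleton l i ih =>
    intro χ hχ hχc v hv hm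
    have hχ' := partialD_contDiff i hχ
    have hχc' := partialD_compact i hχc
    have hv' := partialD_contDiff i hv
    have h1 := ih χ hχ hχc (partialD i v) hv' (fun m hm' => by
      rw [← partialDList_append]
      exact hm _ (by simpa using hm'))
    have h2 := ih (partialD i χ) hχ' hχc' v hv (fun m hm' => hm m (by simp; omega))
    obtain ⟨B, hB⟩ := hχc'.exists_bound_of_continuous hχ'.continuous
    have hml := hm l (by simp)
    set A : ℕ → ℝ≥0∞ := _
    change Tendsto A atTop (𝓝 0) at h1
    set E : ℕ → ℝ≥0∞ := _
    change Tendsto E atTop (𝓝 0) at h2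
    have hlim : Tendsto (fun k => A k + ENNReal.ofReal (rk k) *
        (E k + ENNReal.ofReal B * eLpNorm (partialDList l v) p volume)) atTop (𝓝 0) := by
      have hr : Tendsto (fun k => ENNReal.ofReal (rk k)) atTop (𝓝 0) := by
        simpa using ENNReal.tendsto_ofReal rk_tendsto
      have hK : ENNReal.ofReal B * eLpNorm (partialDList l v) p volume ≠ ⊤ :=
        ENNReal.mul_ne_top ofReal_ne_top hml.2.ne
      have h3 := ENNReal.Tendsto.mul hr (Or.inr (by simpa using hK))
        (h2.add_const (ENNReal.ofReal B * eLpNorm (partialDList l v) p volume))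
        (Or.inr ENNReal.zero_ne_top)
      simpa using h1.add h3
    refine tendsto_of_tendsto_of_tendsto_of_le_of_le tendsto_const_nhds hlim
      (fun _ => zero_le) fun k => ?_
    have hs1 := scale_contDiff hχ (rk k)
    have hs2 := scale_contDiff hχ' (rk k)
    have hp1' : ContDiff ℝ (⊤ : ℕ∞) fun y => χ (rk k • y) * partialD i v y := hs1.mul hv'
    have hp2' : ContDiff ℝ (⊤ : ℕ∞) fun y => partialD i χ (rk k • y) * v y := hs2.mul hv
    have key : partialD i (fun y => χ (rk k • y) * v y)
        = fun y => χ (rk k • y) * partialD i v y + rk k * (partialD i χ (rk k • y) * v y) := by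
      rw [partialD_mul i hs1 hv, partialD_scale i _ hχ]
      ext y; ring
    have e : (fun x => partialDList (l ++ [i]) (fun y => χ (rk k • y) * v y) x
        - χ (rk k • x) * partialDList (l ++ [i]) v x)
      = (fun x => partialDList l (fun y => χ (rk k • y) * partialD i v y) x
          - χ (rk k • x) * partialDList l (partialD i v) x)
        + rk k • ((fun x => partialDList l (fun y => partialD i χ (rk k • y) * v y) x
          - partialD i χ (rk k • x) * partialDList l v x)
          + fun x => partialD i χ (rk k • x) * partialDList l v x) := by
      ext x
      rw [partialDList_append, partialDList_append, key,
        partialDList_add l hp1' (contDiff_const.mul hp2'), partialDList_smul l _ hp2']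
      simp only [Pi.add_apply, Pi.smul_apply, smul_eq_mul]
      ring
    have c1 := (partialDList_contDiff l hp1').continuous
    have c2 := (partialDList_contDiff l hp2').continuous
    have c3 := (partialDList_contDiff l hv').continuous
    have c4 := (partialDList_contDiff l hv).continuous
    have c5 := hs1.continuous
    have c6 := hs2.continuous
    rw [e]
    refine (eLpNorm_add_le (c1.sub (c5.mul c3)).aestronglyMeasurable
      (((c2.sub (c6.mul c4)).add (c6.mul c4)).const_smul (rk k)).aestronglyMeasurable hp1).trans ?_
    refine add_le_add le_rfl ?_
    rw [eLpNorm_const_smul, Real.enorm_eq_ofReal (rk_pos k).le]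
    refine mul_le_mul_right ?_ _
    refine (eLpNorm_add_le (c2.sub (c6.mul c4)).aestronglyMeasurable
      (c6.mul c4).aestronglyMeasurable hp1).trans ?_
    exact add_le_add le_rfl (eLpNorm_mul_bdd p fun x => hB _)

theorem cut_base {n : ℕ} (p : ℝ≥0∞) (hp1 : 1 ≤ p) (hp : p ≠ ⊤)
    (χ : ContDiffBump (0 : EV n)) {w : EV n → ℝ} (hw : MemLp w p volume) :
    Tendsto (fun k : ℕ => eLpNorm (fun x => χ (rk k • x) * w x - w x) p volume) atTop (𝓝 0) := by
  rw [ENNReal.tendsto_nhds_zero]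
  intro δ hδ
  obtain ⟨g, hc, hwg, hg, hgm⟩ := hw.exists_hasCompactSupport_eLpNorm_sub_le hp hδ.ne'
  obtain ⟨R, hR⟩ := hc.isCompact.isBounded.exists_norm_le
  have hlim : Tendsto (fun k => rk k * R) atTop (𝓝 0) := by
    simpa using rk_tendsto.mul_const R
  filter_upwards [hlim.eventually_lt_const χ.rIn_pos] with k hk
  have e : (fun x => χ (rk k • x) * w x - w x) = fun x => (χ (rk k • x) - 1) * (w - g) x := by
    ext x
    by_cases hx : g x = 0
    · simp [hx]; ring
    · have : χ (rk k • x) = 1 := by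
        apply χ.one_of_mem_closedBall
        rw [mem_closedBall_zero_iff, norm_smul, Real.norm_eq_abs, abs_of_pos (rk_pos k)]
        refine le_trans ?_ hk.le
        exact mul_le_mul_of_nonneg_left (hR x (subset_tsupport g hx)) (rk_pos k).le
      simp [this]
  rw [e]
  refine (eLpNorm_mul_bdd (B := 1) p fun x => ?_).trans (by simpa using hwg)
  rw [abs_le]
  constructor <;> linarith [χ.nonneg (x := rk k • x), χ.le_one (x := rk k • x)]

/-- Density of `C_c^∞` in `W^{k,p}`. -/
theorem density {n : ℕ} (k : ℕ) (p : ℝ≥0∞) (hp1 : 1 ≤ p) (hp : p ≠ ⊤) {u : EV n → ℝ}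
    {D : List (Fin n) → EV n → ℝ} (hD : IsSobDerivs Set.univ k p u D) {δ : ℝ} (hδ : 0 < δ) :
    ∃ v : EV n → ℝ, ContDiff ℝ (⊤ : ℕ∞) v ∧ HasCompactSupport v ∧
      ∀ l : List (Fin n), l.length ≤ k →
      eLpNorm (partialDList l v - D l) p volume ≤ ENNReal.ofReal δ := by
  have hδ2 : 0 < δ / 2 := by positivity
  have hδ4 : 0 < δ / 4 := by positivity
  have hmD := hD.2.2
  simp only [Measure.restrict_univ] at hmD
  obtain ⟨v, hv, h⟩ := smooth_approx k p hp1 hp hD hδ2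
  let χ : ContDiffBump (0 : EV n) := ⟨1, 2, one_pos, one_lt_two⟩
  have hχ : ContDiff ℝ (⊤ : ℕ∞) χ := χ.contDiff
  have hfin : {l : List (Fin n) | l.length ≤ k}.Finite := List.finite_length_le _ _
  have hev : ∀ᶠ j : ℕ in atTop, ∀ l ∈ {l : List (Fin n) | l.length ≤ k},
      eLpNorm (fun x => partialDList l (fun y => χ (rk j • y) * v y) x
        - χ (rk j • x) * partialDList l v x) p volume ≤ ENNReal.ofReal (δ / 4) ∧
      eLpNorm (fun x => χ (rk j • x) * partialDList l v x - partialDList l v x) p volume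
        ≤ ENNReal.ofReal (δ / 4) := by
    rw [Set.Finite.eventually_all hfin]
    intro l hl
    have hl' : l.length ≤ k := hl
    have h1 := cut_comm p hp1 l χ hχ χ.hasCompactSupport v hv
      (fun m hm => (h m (hm.trans hl')).1)
    have h2 := cut_base p hp1 hp χ (h l hl').1
    exact (ENNReal.tendsto_nhds_zero.1 h1 _ (ENNReal.ofReal_pos.2 hδ4)).and
      (ENNReal.tendsto_nhds_zero.1 h2 _ (ENNReal.ofReal_pos.2 hδ4))
  obtain ⟨j, hj⟩ := hev.exists
  have hs := scale_contDiff hχ (rk j)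
  have hsv : ContDiff ℝ (⊤ : ℕ∞) (fun y => χ (rk j • y) * v y) := hs.mul hv
  refine ⟨fun y => χ (rk j • y) * v y, hsv, ?_, fun l hl => ?_⟩
  · have : HasCompactSupport (fun y : EV n => χ (rk j • y)) :=
      χ.hasCompactSupport.comp_smul (rk_pos j).ne'
    exact this.mul_right
  · obtain ⟨a1, a2⟩ := hj l hl
    have a3 := (h l hl).2
    have c1 := (partialDList_contDiff l hsv).continuous
    have c2 := (partialDList_contDiff l hv).continuous
    have c3 := hs.continuous
    have e : partialDList l (fun y => χ (rk j • y) * v y) - D l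
      = (fun x => partialDList l (fun y => χ (rk j • y) * v y) x
        - χ (rk j • x) * partialDList l v x)
        + ((fun x => χ (rk j • x) * partialDList l v x - partialDList l v x)
          + (partialDList l v - D l)) := by
      ext x; simp
    rw [e]
    have m3 := c2.aestronglyMeasurable (μ := volume).sub (hmD l hl).1
    have m2 := ((c3.mul c2).sub c2).aestronglyMeasurable (μ := volume)
    refine (eLpNorm_add_le (c1.sub (c3.mul c2)).aestronglyMeasurable (m2.add m3) hp1).trans ?_
    refine (add_le_add a1 ((eLpNorm_add_le m2 m3 hp1).trans (add_le_add a2 a3))).trans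
      (le_of_eq ?_)
    rw [← ENNReal.ofReal_add hδ4.le hδ2.le, ← ENNReal.ofReal_add hδ4.le (by positivity)]
    congr 1; ring

theorem le_of_delta {X W K : ℝ≥0∞} (hK : K ≠ ⊤)
    (h : ∀ δ : ℝ, 0 < δ → X ≤ W + K * ENNReal.ofReal δ) : X ≤ W := by
  have hr : Tendsto (fun k => ENNReal.ofReal (rk k)) atTop (𝓝 0) := by
    simpa using ENNReal.tendsto_ofReal rk_tendsto
  have h2 := (ENNReal.Tendsto.const_mul (a := K) hr (Or.inr hK)).const_add W
  simp only [mul_zero, add_zero] at h2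
  exact ge_of_tendsto' h2 fun k => h _ (rk_pos k)

theorem finite_lists (n k : ℕ) : {l : List (Fin n) | l.length ≤ k}.Finite :=
  List.finite_length_le _ _

theorem WNormD_eq {n : ℕ} (k : ℕ) (p : ℝ≥0∞) (D : List (Fin n) → EV n → ℝ) :
    WNormD k p volume D = ∑ l ∈ (finite_lists n k).toFinset, eLpNorm (D l) p volume := by
  unfold WNormD
  rw [tsum_eq_sum (s := (finite_lists n k).toFinset)]
  · refine Finset.sum_congr rfl fun l hl => ?_
    rw [if_pos (by simpa using hl)]
  · intro l hl
    rw [if_neg (by simpa using hl)]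

theorem thirdG_norm {n : ℕ} {φ : EV n → ℝ} (hφ : ContDiff ℝ (⊤ : ℕ∞) φ)
    (p : ℝ≥0∞) (hp1 : 1 ≤ p) :
    eLpNorm (thirdG φ) p volume ≤ WNormD 3 p volume (fun l => partialDList l φ) := by
  have e : thirdG φ = ∑ t : Fin n × Fin n × Fin n,
      fun x => ‖partialDList [t.1, t.2.1, t.2.2] φ x‖ := by
    ext x
    simp only [thirdG, Finset.sum_apply, Fintype.sum_prod_type, Real.norm_eq_abs]
  rw [e]
  refine (eLpNorm_sum_le (fun t _ => (partialDList_contDiff _ hφ).continuous.norm.aestronglyMeasurable)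
    hp1).trans ?_
  simp only [eLpNorm_norm]
  have hinj : Function.Injective fun t : Fin n × Fin n × Fin n => [t.1, t.2.1, t.2.2] := by
    rintro ⟨a, b, c⟩ ⟨a', b', c'⟩ h
    simpa using h
  have := ENNReal.tsum_comp_le_tsum_of_injective hinj (fun l : List (Fin n) =>
    if l.length ≤ 3 then eLpNorm (partialDList l φ) p volume else 0)
  rw [tsum_fintype] at this
  simpa [WNormD] using this


/-- convergence rate on `ℝⁿ`: there is `C > 0`, depending only on `ρ`
and `p`, such that for all `ε > 0` and `u ∈ W^{3,p}(ℝⁿ)`,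
`‖L_ε u - L u‖_{L^p} ≤ C ε ‖u‖_{W^{3,p}}`, where `L u = -div(M ∇u)` and `L_ε` is (any
choice of) the bounded linear extension of the nonlocal operator to `W^{2,p}(ℝⁿ)`. -/
theorem nlOp_to_local_rate_Rn (n : ℕ) (hn : 1 ≤ n) (ρ : EV n → ℝ) (hρ : A1 ρ)
    (p : ℝ≥0∞) (hp1 : 1 ≤ p) (hp : p ≠ ⊤)
    (L : ℝ → (EV n → ℝ) → EV n → ℝ)
    (hL : ∀ ε : ℝ, 0 < ε → ∃ C : ℝ, 0 < C ∧ IsNLExt ρ p ε C (L ε)) :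
    ∃ C : ℝ, 0 < C ∧ ∀ ε : ℝ, 0 < ε →
      ∀ (u : EV n → ℝ) (D : List (Fin n) → EV n → ℝ),
        IsSobDerivs Set.univ 3 p u D →
        eLpNorm
          (fun x => L ε u x + ∑ i : Fin n, ∑ j : Fin n, momentum ρ i j * D [i, j] x)
          p volume
        ≤ ENNReal.ofReal (C * ε) * WNormD 3 p volume D := by
  have hI0 : 0 ≤ ∫ z, ρ z * ‖z‖ :=
    integral_nonneg fun z => mul_nonneg (hρ.2.1 z) (norm_nonneg z)
  refine ⟨(∫ z, ρ z * ‖z‖) + 1, by positivity, fun ε hε u D hD => ?_⟩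
  obtain ⟨C, hC, hLext, hLlin, hLmem, hLbd⟩ := hL ε hε
  have hmD := hD.2.2
  simp only [Measure.restrict_univ] at hmD
  set C' := ENNReal.ofReal (((∫ z, ρ z * ‖z‖) + 1) * ε) with hC'
  set N2 : ℝ≥0∞ := ((finite_lists n 2).toFinset.card : ℝ≥0∞) with hN2
  set N3 : ℝ≥0∞ := ((finite_lists n 3).toFinset.card : ℝ≥0∞) with hN3
  set SM : ℝ≥0∞ := ∑ i, ∑ j, ‖momentum ρ i j‖ₑ with hSM
  have hSMt : SM ≠ ⊤ := by
    refine ENNReal.sum_ne_top.2 fun i _ => ENNReal.sum_ne_top.2 fun j _ => enorm_ne_top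
  refine le_of_delta (K := ENNReal.ofReal C * N2 + C' * N3 + SM) ?_ fun δ hδ => ?_
  · refine ENNReal.add_ne_top.2 ⟨ENNReal.add_ne_top.2 ⟨?_, ?_⟩, hSMt⟩
    · exact ENNReal.mul_ne_top ofReal_ne_top (by simp [hN2])
    · exact ENNReal.mul_ne_top ofReal_ne_top (by simp [hN3])
  obtain ⟨v, hv, hvc, happ⟩ := density 3 p hp1 hp hD hδ
  have hvm : ∀ l, MemLp (partialDList l v) p volume := fun l =>
    (partialDList_contDiff l hv).continuous.memLp_of_hasCompactSupport (partialDList_compact l hvc)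
  have hvS : IsSobDerivs Set.univ 2 p v (fun l => partialDList l v) := by
    refine ⟨rfl, fun l _ i => classical_weak i (partialDList_contDiff l hv), fun l _ => ?_⟩
    rw [Measure.restrict_univ]; exact hvm l
  have huS : IsSobDerivs Set.univ 2 p u D :=
    ⟨hD.1, fun l hl i => hD.2.1 l (by omega) i, fun l hl => hD.2.2 l (by omega)⟩
  have hdS : IsSobDerivs Set.univ 2 p (fun x => 1 * u x + (-1) * v x)
      (fun l x => D l x - partialDList l v x) := by
    refine ⟨?_, fun l hl i φ hφ hc hs => ?_, fun l hl => ?_⟩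
    · ext x; simp only [hD.1, partialDList]; ring
    · have a1 := hD.2.1 l (by omega) i φ hφ hc hs
      have a2 := classical_weak i (partialDList_contDiff l hv) φ hφ hc hs
      simp only [Measure.restrict_univ] at a1 a2 ⊢
      have li : ∀ (w ψ : EV n → ℝ), MemLp w p volume → ContDiff ℝ (⊤ : ℕ∞) ψ →
          HasCompactSupport ψ → Integrable (fun x => w x * ψ x) volume := by
        intro w ψ hw hψ hψc
        exact (hw.locallyIntegrable hp1).integrable_smul_right_of_hasCompactSupport
          hψ.continuous hψc
      have hp' := partialD_contDiff i hφ
      have hc' := partialD_compact i hc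
      simp only [sub_mul]
      rw [integral_sub (li _ _ (hmD l (by omega)) hp' hc') (li _ _ (hvm l) hp' hc'),
        integral_sub (li _ _ (hmD (i :: l) (by simp; omega)) hφ hc) (li _ _ (hvm _) hφ hc), a1, a2]
      simp only [partialDList]
      ring
    · rw [Measure.restrict_univ]; exact (hmD l (by omega)).sub (hvm l)
  have happ' : ∀ l : List (Fin n), l.length ≤ 3 →
      eLpNorm (fun x => D l x - partialDList l v x) p volume ≤ ENNReal.ofReal δ := fun l hl => by
    have := happ l hl
    rw [eLpNorm_sub_comm] at this
    exact this
  have hW2 : WNormD 2 p volume (fun l x => D l x - partialDList l v x)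
      ≤ N2 * ENNReal.ofReal δ := by
    rw [WNormD_eq, hN2, ← nsmul_eq_mul]
    refine Finset.sum_le_card_nsmul _ _ _ fun l hl => happ' l ?_
    have : l.length ≤ 2 := by simpa using hl
    omega
  have hW3 : WNormD 3 p volume (fun l => partialDList l v)
      ≤ WNormD 3 p volume D + N3 * ENNReal.ofReal δ := by
    rw [WNormD_eq, WNormD_eq, hN3, ← nsmul_eq_mul, ← Finset.sum_const, ← Finset.sum_add_distrib]
    refine Finset.sum_le_sum fun l hl => ?_
    have hl' : l.length ≤ 3 := by simpa using hl
    have e : partialDList l v = D l + (partialDList l v - D l) := by simp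
    rw [e]
    exact (eLpNorm_add_le (hmD l hl').1 ((hvm l).1.sub (hmD l hl').1) hp1).trans
      (add_le_add le_rfl (happ l hl'))
  have hlin := hLlin u v ⟨D, huS⟩ ⟨_, hvS⟩ 1 (-1)
  have hLv := hLext v (contDiff_infty.1 hv 2) hvc
  have b1 : eLpNorm (fun x => L ε u x - L ε v x) p volume
      ≤ ENNReal.ofReal C * (N2 * ENNReal.ofReal δ) := by
    have := (hLbd _ _ hdS).trans (mul_le_mul_right hW2 _)
    rw [eLpNorm_congr_ae hlin] at this
    simpa [sub_eq_add_neg] using this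
  have b2 : eLpNorm (fun x => L ε v x + ∑ i, ∑ j, momentum ρ i j * partialDList [i, j] v x)
      p volume ≤ C' * (WNormD 3 p volume D + N3 * ENNReal.ofReal δ) := by
    have e : (fun x => L ε v x + ∑ i, ∑ j, momentum ρ i j * partialDList [i, j] v x)
        =ᵐ[volume] fun x => nlOp ρ ε v x + ∑ i, ∑ j, momentum ρ i j * partialDList [i, j] v x := by
      filter_upwards [hLv] with x hx
      rw [hx]
    rw [eLpNorm_congr_ae e]
    refine (smooth_rate hρ hε hv hvc p hp1 hp).trans ?_
    refine mul_le_mul' (ENNReal.ofReal_le_ofReal ?_) ((thirdG_norm hv p hp1).trans hW3)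
    nlinarith
  have b3 : eLpNorm (∑ i, ∑ j, momentum ρ i j • fun x => (D [i, j] x - partialDList [i, j] v x))
      p volume ≤ SM * ENNReal.ofReal δ := by
    have ms : ∀ i j, AEStronglyMeasurable
        (momentum ρ i j • fun x => (D [i, j] x - partialDList [i, j] v x)) volume := fun i j =>
      ((hmD [i, j] (by simp)).1.sub (hvm [i, j]).1).const_smul _
    refine (eLpNorm_sum_le (fun i _ => Finset.aestronglyMeasurable_sum _ fun j _ => ms i j)
      hp1).trans ?_
    rw [hSM, Finset.sum_mul]
    refine Finset.sum_le_sum fun i _ => ?_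
    refine (eLpNorm_sum_le (fun j _ => ms i j) hp1).trans ?_
    rw [Finset.sum_mul]
    refine Finset.sum_le_sum fun j _ => ?_
    rw [eLpNorm_const_smul]
    exact mul_le_mul_right (happ' [i, j] (by simp)) _
  have e : (fun x => L ε u x + ∑ i : Fin n, ∑ j : Fin n, momentum ρ i j * D [i, j] x)
      = (fun x => L ε u x - L ε v x)
        + ((fun x => L ε v x + ∑ i, ∑ j, momentum ρ i j * partialDList [i, j] v x)
        + ∑ i, ∑ j, momentum ρ i j • fun x => (D [i, j] x - partialDList [i, j] v x)) := by
    ext x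
    simp only [Pi.add_apply, Finset.sum_apply, Pi.smul_apply, smul_eq_mul, mul_sub,
      Finset.sum_sub_distrib]
    ring
  have hLu := (hLmem u ⟨D, huS⟩).1
  have hLv' := (hLmem v ⟨_, hvS⟩).1
  have m2 : AEStronglyMeasurable
      (fun x => L ε v x + ∑ i, ∑ j, momentum ρ i j * partialDList [i, j] v x) volume := by
    refine hLv'.add (Continuous.aestronglyMeasurable ?_)
    exact continuous_finsetSum _ fun i _ => continuous_finsetSum _ fun j _ =>
      continuous_const.mul (partialDList_contDiff [i, j] hv).continuous
  have m3 : AEStronglyMeasurable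
      (∑ i, ∑ j, momentum ρ i j • fun x => (D [i, j] x - partialDList [i, j] v x)) volume :=
    Finset.aestronglyMeasurable_sum _ fun i _ => Finset.aestronglyMeasurable_sum _ fun j _ =>
      ((hmD [i, j] (by simp)).1.sub (hvm [i, j]).1).const_smul _
  rw [e]
  refine (eLpNorm_add_le (hLu.sub hLv') (m2.add m3) hp1).trans ?_
  refine (add_le_add b1 ((eLpNorm_add_le m2 m3 hp1).trans (add_le_add b2 b3))).trans
    (le_of_eq ?_)
  ring
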